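/- For every SLG G = (V, Σ, R, S) with |exp_G(S)| ≥ 2, there exists an admissible SLG G' = (V', Σ, R', S') satisfying L(G') = L(G), Σ_{X ∈ V'} |exp_{G'}(X)| ≤ C · log|G| · Σ_{X ∈ V} |exp_G(X)| for an absolute constant C, and |G'| ≤ 2|G|. -/

import Mathlib

/-- A straight-line grammar (SLG) over terminal alphabet `T` with set of nonterminals `N`:
every nonterminal has exactly one production rule (symbols are `N ⊕ T`). -/
structure SLG (T : Type) (N : Type) where
  start : N
  rhs : N → List (N ⊕ T)

namespace SLG

variable {T N : Type}

/-- One rewriting step: replace one occurrence of a nonterminal by its right-hand side. -/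
def Produces (G : SLG T N) (x y : List (N ⊕ T)) : Prop :=
  ∃ (p q : List (N ⊕ T)) (X : N),
    x = p ++ Sum.inl X :: q ∧ y = p ++ G.rhs X ++ q

/-- The derivation relation of an SLG. -/
def Derives (G : SLG T N) : List (N ⊕ T) → List (N ⊕ T) → Prop :=
  Relation.ReflTransGen G.Produces

/-- `u` is the (necessarily unique) expansion `exp_G(X)` of the nonterminal `X`. -/
def IsExp (G : SLG T N) (X : N) (u : List T) : Prop :=
  G.Derives [Sum.inl X] (u.map Sum.inr)

/-- The language of an SLG; for an SLG it equals `{exp_G(S)}`. -/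
def language (G : SLG T N) : Set (List T) :=
  { u | G.IsExp G.start u }

/-- `Y` occurs in the parse tree of `X`. -/
def Reaches (G : SLG T N) : N → N → Prop :=
  Relation.ReflTransGen (fun X Y => Sum.inl Y ∈ G.rhs X)

/-- An SLG is admissible if every right-hand side consists of exactly two symbols and
every nonterminal occurs in the parse tree of the start symbol. -/
def Admissible (G : SLG T N) : Prop :=
  (∀ X, (G.rhs X).length = 2) ∧ (∀ X, G.Reaches G.start X)

/-- The size of an SLG: the total length of the right-hand sides of all its rules. -/
def size (G : SLG T N) [Fintype N] : ℕ :=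
  ∑ X : N, (G.rhs X).length

end SLG

namespace SLG

variable {T N : Type}

theorem Produces.append_left {G : SLG T N} {x y : List (N ⊕ T)} (a : List (N ⊕ T))
    (h : G.Produces x y) : G.Produces (a ++ x) (a ++ y) := by
  obtain ⟨p, q, X, rfl, rfl⟩ := h
  exact ⟨a ++ p, q, X, by simp, by simp⟩

theorem Produces.append_right {G : SLG T N} {x y : List (N ⊕ T)} (b : List (N ⊕ T))
    (h : G.Produces x y) : G.Produces (x ++ b) (y ++ b) := by
  obtain ⟨p, q, X, rfl, rfl⟩ := h
  exact ⟨p, q ++ b, X, by simp, by simp⟩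

theorem Derives.append {G : SLG T N} {a a' b b' : List (N ⊕ T)}
    (ha : G.Derives a a') (hb : G.Derives b b') : G.Derives (a ++ b) (a' ++ b') :=
  (Relation.ReflTransGen.lift (· ++ b) (fun _ _ => Produces.append_right b) _ _ ha).trans
    (Relation.ReflTransGen.lift (a' ++ ·) (fun _ _ => Produces.append_left a') _ _ hb)

theorem produces_rhs (G : SLG T N) (X : N) : G.Produces [Sum.inl X] (G.rhs X) :=
  ⟨[], [], X, by simp, by simp⟩

theorem Produces.append_cases {G : SLG T N} {a b c : List (N ⊕ T)}
    (h : G.Produces (a ++ b) c) :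
    (∃ a', G.Produces a a' ∧ c = a' ++ b) ∨ (∃ b', G.Produces b b' ∧ c = a ++ b') := by
  obtain ⟨p, q, X, hx, rfl⟩ := h
  rcases List.append_eq_append_iff.1 hx with ⟨r, rfl, hb⟩ | ⟨r, ha, hq⟩
  · exact Or.inr ⟨r ++ G.rhs X ++ q, ⟨r, q, X, hb, rfl⟩, by simp⟩
  · rcases r with _ | ⟨s, r⟩
    · simp only [List.append_nil, List.nil_append] at ha hq
      subst ha
      exact Or.inr ⟨G.rhs X ++ q, ⟨[], q, X, by simp [hq], by simp⟩, by simp⟩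
    · simp only [List.cons_append, List.cons.injEq] at hq
      obtain ⟨rfl, rfl⟩ := hq
      exact Or.inl ⟨p ++ G.rhs X ++ r, ⟨p, r, X, ha, rfl⟩, by simp⟩

theorem Derives.append_cases {G : SLG T N} {a b c : List (N ⊕ T)}
    (h : G.Derives (a ++ b) c) :
    ∃ a' b', c = a' ++ b' ∧ G.Derives a a' ∧ G.Derives b b' := by
  induction h with
  | refl => exact ⟨a, b, rfl, .refl, .refl⟩
  | tail _ hp ih =>
    obtain ⟨a', b', rfl, ha, hb⟩ := ih
    rcases hp.append_cases with ⟨a'', hp', rfl⟩ | ⟨b'', hp', rfl⟩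
    · exact ⟨a'', b', rfl, ha.tail hp', hb⟩
    · exact ⟨a', b'', rfl, ha, hb.tail hp'⟩

theorem not_produces_map_inr {G : SLG T N} {u : List T} {y : List (N ⊕ T)} :
    ¬ G.Produces (u.map Sum.inr) y := by
  rintro ⟨p, q, X, hx, -⟩
  have : Sum.inl X ∈ u.map (Sum.inr : T → N ⊕ T) := by simp [hx]
  simp at this

theorem IsExp.derives_rhs {G : SLG T N} {X : N} {u : List T} (h : G.IsExp X u) :
    G.Derives (G.rhs X) (u.map Sum.inr) := by
  rcases Relation.ReflTransGen.cases_head h with h | ⟨c, ⟨p, q, Y, hx, rfl⟩, h⟩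
  · have : Sum.inl X ∈ u.map (Sum.inr : T → N ⊕ T) := by simp [← h]
    simp at this
  · rcases p with _ | ⟨s, p⟩
    · simp only [List.nil_append, List.cons.injEq, Sum.inl.injEq] at hx
      obtain ⟨rfl, rfl⟩ := hx
      rwa [List.nil_append, List.append_nil] at h
    · simp at hx

/-- Bottom-up induction on the parse trees of a straight-line grammar. -/
theorem Derives.induction {G : SLG T N} {P : N → Prop}
    (step : ∀ X, (∀ Y, Sum.inl Y ∈ G.rhs X → P Y) → P X) {l : List (N ⊕ T)} {u : List T}
    (h : G.Derives l (u.map Sum.inr)) : ∀ X, Sum.inl X ∈ l → P X := by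
  induction h using Relation.ReflTransGen.head_induction_on with
  | refl => simp
  | head hp _ ih =>
    obtain ⟨p, q, Y, rfl, rfl⟩ := hp
    intro X hX
    simp only [List.mem_append, List.mem_cons, Sum.inl.injEq] at hX ih
    rcases hX with hX | rfl | hX
    · exact ih X (.inl (.inl hX))
    · exact step X fun Z hZ => ih Z (.inl (.inr hZ))
    · exact ih X (.inr hX)

theorem IsExp.induction {G : SLG T N} {P : N → Prop}
    (step : ∀ X, (∀ Y, Sum.inl Y ∈ G.rhs X → P Y) → P X) {X : N} {u : List T}
    (h : G.IsExp X u) : P X :=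
  Derives.induction step h X (by simp)

/-- The expansion of a symbol, given the expansions of the nonterminals. -/
def symbolExp (e : N → List T) : N ⊕ T → List T :=
  Sum.elim e fun t => [t]

theorem Derives.eq_flatMap_of_unique {G : SLG T N} {e : N → List T} {l : List (N ⊕ T)}
    {u : List T} (h : G.Derives l (u.map Sum.inr))
    (hl : ∀ Y, Sum.inl Y ∈ l → ∀ v, G.IsExp Y v → v = e Y) :
    u = l.flatMap (symbolExp e) := by
  induction l generalizing u with
  | nil =>
    rcases Relation.ReflTransGen.cases_head h with h | ⟨c, ⟨p, q, Y, hx, -⟩, -⟩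
    · simpa using h.symm
    · simp at hx
  | cons s l ih =>
    obtain ⟨a, b, hab, ha, hb⟩ := Derives.append_cases (a := [s]) (b := l) h
    obtain ⟨v, w, rfl, rfl, rfl⟩ := List.map_eq_append_iff.1 hab
    rw [List.flatMap_cons, ← ih hb fun Y hY => hl Y (List.mem_cons_of_mem _ hY)]
    congr 1
    rcases s with Y | t
    · exact hl Y (by simp) v ha
    · rcases Relation.ReflTransGen.cases_head ha with h | ⟨c, hp, -⟩
      · rcases v with _ | ⟨x, _ | ⟨y, v⟩⟩ <;> simp_all [symbolExp]
      · exact absurd hp (not_produces_map_inr (u := [t]))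

theorem IsExp.eq_flatMap {G : SLG T N} {e : N → List T} (he : ∀ X, G.IsExp X (e X)) {X : N}
    {u : List T} (h : G.IsExp X u) : u = (G.rhs X).flatMap (symbolExp e) := by
  refine IsExp.induction (G := G)
    (P := fun X => ∀ u, G.IsExp X u → u = (G.rhs X).flatMap (symbolExp e)) ?_ (he X) u h
  intro X ih u hu
  exact hu.derives_rhs.eq_flatMap_of_unique fun Y hY v hv =>
    (ih Y hY v hv).trans (ih Y hY _ (he Y)).symm

theorem language_eq_singleton {G : SLG T N} {e : N → List T} (he : ∀ X, G.IsExp X (e X)) :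
    G.language = {e G.start} := by
  ext u
  refine ⟨fun h => (h.eq_flatMap he).trans ((he G.start).eq_flatMap he).symm, ?_⟩
  rintro rfl
  exact he G.start

end SLG

/-- Every word of `A` is a concatenation of two words, each in `A` or satisfying `P`. -/
def SplitsInto {T : Type} (A : Finset (List T)) (P : List T → Prop) : Prop :=
  ∀ w ∈ A, ∃ u v, w = u ++ v ∧ u ≠ [] ∧ v ≠ [] ∧ (u ∈ A ∨ P u) ∧ (v ∈ A ∨ P v)

/-- Balanced binarization of a concatenation of at most `2 ^ d` nonempty words. -/
theorem exists_balanced_splitting {T : Type} (d : ℕ) (L : List (List T)) (hne : ∀ w ∈ L, w ≠ [])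
    (hd : L.length ≤ 2 ^ d) :
    ∃ B : Finset (List T), B.card ≤ L.length - 1 ∧
      ∑ w ∈ B, w.length ≤ d * L.flatten.length ∧
      SplitsInto B (· ∈ L) ∧ (L ≠ [] → L.flatten ∈ B ∨ L.flatten ∈ L) := by
  classical
  induction d generalizing L with
  | zero =>
    refine ⟨∅, by simp, by simp, by simp [SplitsInto], fun hL => .inr ?_⟩
    obtain ⟨w, rfl⟩ : ∃ w, L = [w] := by
      rw [← List.length_eq_one_iff]
      have := List.length_pos_iff.2 hL
      simp at hd
      omega
    simp
  | succ d ih =>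
    by_cases hL : L.length ≤ 1
    · refine ⟨∅, by simp, by simp, by simp [SplitsInto], fun hL' => .inr ?_⟩
      obtain ⟨w, rfl⟩ : ∃ w, L = [w] := by
        rw [← List.length_eq_one_iff]
        have := List.length_pos_iff.2 hL'
        omega
      simp
    · obtain ⟨L₁, L₂, rfl, h₁, h₂, h₁', h₂'⟩ : ∃ L₁ L₂, L = L₁ ++ L₂ ∧ L₁.length ≤ 2 ^ d ∧
          L₂.length ≤ 2 ^ d ∧ L₁ ≠ [] ∧ L₂ ≠ [] := by
        rw [pow_succ] at hd
        refine ⟨L.take (L.length / 2), L.drop (L.length / 2), by simp, ?_, ?_, ?_, ?_⟩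
        · rw [List.length_take]; omega
        · rw [List.length_drop]; omega
        · rw [← List.length_pos_iff, List.length_take]; omega
        · rw [← List.length_pos_iff, List.length_drop]; omega
      have hne₁ : ∀ w ∈ L₁, w ≠ [] := fun w hw => hne w (by simp [hw])
      have hne₂ : ∀ w ∈ L₂, w ≠ [] := fun w hw => hne w (by simp [hw])
      obtain ⟨B₁, hc₁, hs₁, hb₁, hf₁⟩ := ih L₁ hne₁ h₁
      obtain ⟨B₂, hc₂, hs₂, hb₂, hf₂⟩ := ih L₂ hne₂ h₂
      have flatten_ne : ∀ M : List (List T), M ≠ [] → (∀ w ∈ M, w ≠ []) → M.flatten ≠ [] := by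
        intro M hM h hM'
        obtain ⟨w, hw⟩ := List.exists_mem_of_ne_nil M hM
        exact h w hw (List.flatten_eq_nil_iff.1 hM' w hw)
      refine ⟨insert (L₁ ++ L₂).flatten (B₁ ∪ B₂), ?_, ?_, ?_, fun _ => .inl (by simp)⟩
      · have p₁ := List.length_pos_iff.2 h₁'
        have p₂ := List.length_pos_iff.2 h₂'
        have := Finset.card_insert_le (L₁ ++ L₂).flatten (B₁ ∪ B₂)
        have := Finset.card_union_le B₁ B₂
        rw [List.length_append]
        omega
      · have i₁ : ∑ w ∈ insert (L₁ ++ L₂).flatten (B₁ ∪ B₂), w.length ≤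
            (L₁ ++ L₂).flatten.length + ∑ w ∈ B₁ ∪ B₂, w.length := by
          by_cases h : (L₁ ++ L₂).flatten ∈ B₁ ∪ B₂
          · rw [Finset.insert_eq_of_mem h]; omega
          · rw [Finset.sum_insert h]
        have i₂ := Finset.sum_union_inter (s₁ := B₁) (s₂ := B₂) (f := List.length)
        have i₃ : (L₁ ++ L₂).flatten.length = L₁.flatten.length + L₂.flatten.length := by
          rw [List.flatten_append, List.length_append]
        rw [i₃] at i₁ ⊢
        rw [add_one_mul, mul_add]
        omega
      · intro w hw
        rw [Finset.mem_insert, Finset.mem_union] at hw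
        rcases hw with rfl | hw | hw
        · refine ⟨L₁.flatten, L₂.flatten, by simp, flatten_ne _ h₁' hne₁, flatten_ne _ h₂' hne₂,
            ?_, ?_⟩
          · rcases hf₁ h₁' with h | h
            · exact .inl (by simp [h])
            · exact .inr (List.mem_append_left _ h)
          · rcases hf₂ h₂' with h | h
            · exact .inl (by simp [h])
            · exact .inr (List.mem_append_right _ h)
        · obtain ⟨u, v, rfl, hu, hv, hu', hv'⟩ := hb₁ w hw
          refine ⟨u, v, rfl, hu, hv, ?_, ?_⟩
          · exact hu'.imp (by simp +contextual) (List.mem_append_left _)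
          · exact hv'.imp (by simp +contextual) (List.mem_append_left _)
        · obtain ⟨u, v, rfl, hu, hv, hu', hv'⟩ := hb₂ w hw
          refine ⟨u, v, rfl, hu, hv, ?_, ?_⟩
          · exact hu'.imp (by simp +contextual) (List.mem_append_right _)
          · exact hv'.imp (by simp +contextual) (List.mem_append_right _)

namespace SLG

/-- A set of words closed under splitting carries a grammar deriving each of its words from
two symbols. -/
theorem exists_binary {T : Type} (A : Finset (List T)) (hA : SplitsInto A (·.length = 1))
    {w₀ : List T} (hw₀ : w₀ ∈ A) :
    ∃ G : SLG T A, G.start = ⟨w₀, hw₀⟩ ∧ (∀ X, (G.rhs X).length = 2) ∧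
      (∀ X, X.1 = (G.rhs X).flatMap (symbolExp Subtype.val)) ∧
      ∀ X, ∀ s ∈ G.rhs X, symbolExp Subtype.val s ≠ [] := by
  have symbol : ∀ u : List T, u ∈ A ∨ u.length = 1 →
      ∃ s : A ⊕ T, symbolExp Subtype.val s = u := by
    rintro u (hu | hu)
    · exact ⟨.inl ⟨u, hu⟩, rfl⟩
    · obtain ⟨t, rfl⟩ := List.length_eq_one_iff.1 hu
      exact ⟨.inr t, rfl⟩
  have rule : ∀ X : A, ∃ l : List (A ⊕ T), l.length = 2 ∧
      X.1 = l.flatMap (symbolExp Subtype.val) ∧ ∀ s ∈ l, symbolExp Subtype.val s ≠ [] := by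
    rintro ⟨w, hw⟩
    obtain ⟨u, v, rfl, hu, hv, hu', hv'⟩ := hA w hw
    obtain ⟨s, rfl⟩ := symbol u hu'
    obtain ⟨t, rfl⟩ := symbol v hv'
    exact ⟨[s, t], by simp, by simp, by simp [hu, hv]⟩
  choose f h₁ h₂ h₃ using rule
  exact ⟨⟨⟨w₀, hw₀⟩, f⟩, rfl, h₁, h₂, h₃⟩

theorem derives_flatMap {T N : Type} {G : SLG T N} {e : N → List T} (l : List (N ⊕ T))
    (h : ∀ Y, Sum.inl Y ∈ l → G.IsExp Y (e Y)) :
    G.Derives l ((l.flatMap (symbolExp e)).map Sum.inr) := by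
  induction l with
  | nil => exact .refl
  | cons s l ih =>
    rw [List.flatMap_cons, List.map_append]
    refine Derives.append (a := [s]) ?_ (ih fun Y hY => h Y (List.mem_cons_of_mem _ hY))
    rcases s with Y | t
    · exact h Y (by simp)
    · exact .refl

theorem isExp_of_binary {T N : Type} {G : SLG T N} {e : N → List T}
    (h₂ : ∀ X, (G.rhs X).length = 2) (he : ∀ X, e X = (G.rhs X).flatMap (symbolExp e))
    (hne : ∀ X, ∀ s ∈ G.rhs X, symbolExp e s ≠ []) (X : N) : G.IsExp X (e X) := by
  induction hn : (e X).length using Nat.strong_induction_on generalizing X with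
  | _ n ih =>
    subst hn
    have key : ∀ Y, Sum.inl Y ∈ G.rhs X → G.IsExp Y (e Y) := by
      intro Y hY
      refine ih _ ?_ Y rfl
      have hlen := congrArg List.length (he X)
      obtain ⟨s, t, hst⟩ := List.length_eq_two.1 (h₂ X)
      have hs := List.length_pos_iff.2 (hne X s (by simp [hst]))
      have ht := List.length_pos_iff.2 (hne X t (by simp [hst]))
      simp only [hst, List.flatMap_cons, List.flatMap_nil, List.append_nil,
        List.length_append] at hlen
      simp only [hst, List.mem_cons, List.not_mem_nil, or_false] at hY
      rcases hY with rfl | rfl <;> simp only [symbolExp, Sum.elim_inl] at * <;> omega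
    have := derives_flatMap (G.rhs X) key
    rw [← he X] at this
    exact .head (G.produces_rhs X) this

/-- Renaming of nonterminals along an equivalence. -/
def rename {T N M : Type} (G : SLG T N) (f : N ≃ M) : SLG T M where
  start := f G.start
  rhs X := (G.rhs (f.symm X)).map (Sum.map f id)

theorem Reaches.rename {T N M : Type} {G : SLG T N} (f : N ≃ M) {X Y : N}
    (h : G.Reaches X Y) : (G.rename f).Reaches (f X) (f Y) := by
  refine Relation.ReflTransGen.lift f (fun X Y h => ?_) _ _ h
  change Sum.inl (f Y) ∈ (G.rhs (f.symm (f X))).map (Sum.map f id)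
  rw [Equiv.symm_apply_apply]
  exact List.mem_map.2 ⟨_, h, rfl⟩

/-- A finite set of words closed under splitting yields an admissible grammar whose nonterminals
expand to distinct words of the set. -/
theorem exists_admissible {T : Type} (A : Finset (List T)) (hA : SplitsInto A (·.length = 1))
    {w₀ : List T} (hw₀ : w₀ ∈ A) :
    ∃ (n : ℕ) (G : SLG T (Fin n)) (e : Fin n → List T),
      (∀ X, G.IsExp X (e X)) ∧ G.Admissible ∧ e G.start = w₀ ∧
      ∑ X, (e X).length ≤ ∑ w ∈ A, w.length ∧ n ≤ A.card := by
  classical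
  induction hn : A.card using Nat.strong_induction_on generalizing A with
  | _ n ih =>
    subst hn
    obtain ⟨G, hstart, h₂, he, hne⟩ := exists_binary A hA hw₀
    by_cases hr : ∀ X, G.Reaches G.start X
    · have hexp : ∀ X, symbolExp (fun Y => (A.equivFin.symm Y).1)
          (Sum.map A.equivFin id X) = symbolExp (T := T) Subtype.val X := by
        rintro (X | t) <;> simp [symbolExp]
      have h₂' : ∀ X, ((G.rename A.equivFin).rhs X).length = 2 := fun X => by
        simp [SLG.rename, h₂]
      refine ⟨A.card, G.rename A.equivFin, fun X => (A.equivFin.symm X).1,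
        isExp_of_binary h₂' ?_ ?_, ⟨h₂', fun X => ?_⟩, ?_, ?_, le_rfl⟩
      · intro X
        simp only [SLG.rename, List.flatMap_map, hexp]
        exact he _
      · intro X s hs
        simp only [SLG.rename, List.mem_map] at hs
        obtain ⟨t, ht, rfl⟩ := hs
        rw [hexp]
        exact hne _ t ht
      · have := (hr (A.equivFin.symm X)).rename A.equivFin
        rwa [Equiv.apply_symm_apply] at this
      · simp [SLG.rename, hstart]
      · rw [Equiv.sum_comp A.equivFin.symm (fun w : A => w.1.length), Finset.sum_coe_sort]
    · push Not at hr
      obtain ⟨Z, hZ⟩ := hr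
      let B : Finset (List T) := (Finset.univ.filter fun X : A => G.Reaches G.start X).map
        ⟨Subtype.val, Subtype.val_injective⟩
      have mem_B : ∀ X : A, X.1 ∈ B ↔ G.Reaches G.start X := by
        intro X
        simp [B]
      have hBA : B ⊆ A := by
        intro w hw
        simp only [B, Finset.mem_map] at hw
        obtain ⟨X, -, rfl⟩ := hw
        exact X.2
      have hlt : B.card < A.card :=
        Finset.card_lt_card ⟨hBA, fun h => hZ ((mem_B Z).1 (h Z.2))⟩
      have hB : SplitsInto B (·.length = 1) := by
        intro w hw
        obtain ⟨X, rfl⟩ : ∃ X : A, X.1 = w := ⟨⟨w, hBA hw⟩, rfl⟩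
        have hX := (mem_B X).1 hw
        obtain ⟨s, t, hst⟩ := List.length_eq_two.1 (h₂ X)
        have mem_or : ∀ s ∈ G.rhs X, symbolExp Subtype.val s ∈ B ∨
            (symbolExp Subtype.val s).length = 1 := by
          rintro (Y | t) hs
          · exact .inl ((mem_B Y).2 (hX.tail hs))
          · exact .inr rfl
        refine ⟨symbolExp Subtype.val s, symbolExp Subtype.val t, ?_, hne X s (by simp [hst]),
          hne X t (by simp [hst]), mem_or s (by simp [hst]), mem_or t (by simp [hst])⟩
        have := he X
        simpa [hst] using this
      have hw₀B : w₀ ∈ B := (mem_B ⟨w₀, hw₀⟩).2 (hstart ▸ .refl)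
      obtain ⟨n, G', e, h₁, h₂, h₃, h₄, h₅⟩ := ih _ hlt B hB hw₀B rfl
      exact ⟨n, G', e, h₁, h₂, h₃, h₄.trans (Finset.sum_le_sum_of_subset hBA), by omega⟩

end SLG

theorem Finset.sum_biUnion_le_sum_sum {ι α : Type*} [DecidableEq α] (s : Finset ι)
    (B : ι → Finset α) (f : α → ℕ) : ∑ w ∈ s.biUnion B, f w ≤ ∑ i ∈ s, ∑ w ∈ B i, f w := by
  classical
  induction s using Finset.induction_on with
  | empty => simp
  | insert i s hi ih =>
    rw [Finset.biUnion_insert, Finset.sum_insert hi]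
    have := Finset.sum_union_inter (s₁ := B i) (s₂ := s.biUnion B) (f := f)
    omega

/-- For every SLG `G = (V, Σ, R, S)` with `|exp_G(S)| ≥ 2` there is an
admissible SLG `G'` with `L(G') = L(G)`,
`Σ_{X ∈ V'} |exp_{G'}(X)| ≤ C · log|G| · Σ_{X ∈ V} |exp_G(X)|` for an absolute constant
`C`, and `|G'| ≤ 2|G|`. -/
theorem to_admissible :
    ∃ C : ℕ, ∀ (T N : Type) [Fintype N] (G : SLG T N) (expn : N → List T),
      (∀ X, G.IsExp X (expn X)) →
      2 ≤ (expn G.start).length →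
      ∃ (n' : ℕ) (G' : SLG T (Fin n')) (expn' : Fin n' → List T),
        (∀ X, G'.IsExp X (expn' X)) ∧
        G'.Admissible ∧
        G'.language = G.language ∧
        (∑ X : Fin n', (expn' X).length) ≤
          C * Nat.log 2 G.size * ∑ X : N, (expn X).length ∧
        G'.size ≤ 2 * G.size := by
  classical
  refine ⟨2, fun T N _ G e he h2 => ?_⟩
  have heq : ∀ X, e X = (G.rhs X).flatMap (SLG.symbolExp e) := fun X => (he X).eq_flatMap he
  let L : N → List (List T) := fun X => ((G.rhs X).map (SLG.symbolExp e)).filter (· ≠ [])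
  have hL : ∀ X, (L X).flatten = e X := by
    intro X
    rw [heq X, List.flatMap_def]
    exact List.flatten_filter_ne_nil
  have hlen : ∀ X, (L X).length ≤ (G.rhs X).length := fun X =>
    (List.length_filter_le _ _).trans_eq (by simp)
  have hsize : ∀ X, (G.rhs X).length ≤ G.size := fun X =>
    Finset.single_le_sum (f := fun X => (G.rhs X).length) (fun _ _ => Nat.zero_le _)
      (Finset.mem_univ X)
  have hmem : ∀ X, ∀ w ∈ L X, w ≠ [] ∧ ∃ s ∈ G.rhs X, SLG.symbolExp e s = w := by
    intro X w hw
    simp only [L, List.mem_filter, List.mem_map, decide_eq_true_eq] at hw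
    exact ⟨hw.2, hw.1⟩
  choose B hcard hsum hsplit hflat using fun X =>
    exists_balanced_splitting (Nat.clog 2 G.size) (L X) (fun w hw => (hmem X w hw).1)
      (((hlen X).trans (hsize X)).trans (Nat.le_pow_clog one_lt_two _))
  let A : Finset (List T) := Finset.univ.biUnion B
  have mem_A : ∀ X, ∀ w ∈ B X, w ∈ A := fun X w hw =>
    Finset.mem_biUnion.2 ⟨X, Finset.mem_univ X, hw⟩
  have exp_mem : ∀ X, 2 ≤ (e X).length → e X ∈ A := by
    intro X
    refine SLG.IsExp.induction (G := G) (P := fun X => 2 ≤ (e X).length → e X ∈ A) ?_ (he X)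
    intro X ih hX
    have hne : L X ≠ [] := by
      intro h
      have := hL X
      rw [h] at this
      simp [← this] at hX
    rcases hflat X hne with h | h
    · exact mem_A X _ (hL X ▸ h)
    · rw [hL X] at h
      obtain ⟨-, Y | t, hs, hw⟩ := hmem X _ h
      · change e Y = e X at hw
        rw [← hw] at hX ⊢
        exact ih Y hs hX
      · simp [← hw, SLG.symbolExp] at hX
  have hA : SplitsInto A (·.length = 1) := by
    intro w hw
    obtain ⟨X, -, hw⟩ := Finset.mem_biUnion.1 hw
    obtain ⟨u, v, rfl, hu, hv, hu', hv'⟩ := hsplit X w hw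
    have lift : ∀ u, u ∈ B X ∨ u ∈ L X → u ∈ A ∨ u.length = 1 := by
      rintro u (h | h)
      · exact .inl (mem_A X u h)
      · obtain ⟨hne, Y | t, -, rfl⟩ := hmem X u h
        · change e Y ≠ [] at hne
          change e Y ∈ A ∨ (e Y).length = 1
          have := List.length_pos_iff.2 hne
          by_cases h1 : (e Y).length = 1
          · exact .inr h1
          · exact .inl (exp_mem Y (by omega))
        · exact .inr rfl
    exact ⟨u, v, rfl, hu, hv, lift u hu', lift v hv'⟩
  obtain ⟨n, G', e', he', hadm, hstart, hsum', hn⟩ :=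
    SLG.exists_admissible A hA (exp_mem _ h2)
  have two_le : 2 ≤ G.size := by
    obtain ⟨X, -, hX⟩ := Finset.mem_biUnion.1 (exp_mem _ h2)
    have := Finset.card_pos.2 ⟨_, hX⟩
    have := hcard X
    have := hlen X
    have := hsize X
    omega
  have clog_le : Nat.clog 2 G.size ≤ 2 * Nat.log 2 G.size := by
    have h₁ : 1 ≤ Nat.log 2 G.size := Nat.log_pos one_lt_two two_le
    have h₂ : Nat.clog 2 G.size ≤ Nat.log 2 G.size + 1 :=
      Nat.clog_le_of_le_pow (Nat.lt_pow_succ_log_self one_lt_two _).le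
    omega
  refine ⟨n, G', e', he', hadm, ?_, ?_, ?_⟩
  · rw [SLG.language_eq_singleton he', SLG.language_eq_singleton he, hstart]
  · calc ∑ X, (e' X).length ≤ ∑ w ∈ A, w.length := hsum'
      _ ≤ ∑ X, ∑ w ∈ B X, w.length := Finset.sum_biUnion_le_sum_sum _ _ _
      _ ≤ ∑ X, Nat.clog 2 G.size * (e X).length :=
        Finset.sum_le_sum fun X _ => by simpa only [hL] using hsum X
      _ = Nat.clog 2 G.size * ∑ X, (e X).length := by rw [Finset.mul_sum]
      _ ≤ 2 * Nat.log 2 G.size * ∑ X, (e X).length := Nat.mul_le_mul_right _ clog_le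
  · have hA_card : A.card ≤ G.size := Finset.card_biUnion_le.trans <|
      Finset.sum_le_sum fun X _ => (hcard X).trans ((Nat.sub_le _ _).trans (hlen X))
    have : G'.size = n * 2 := by simp [SLG.size, hadm.1]
    omega
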